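/- Let L be a number field and D a finite-dimensional central simple algebra over L (hence D is finite-dimensional over ℚ). Call a subring R of D an order if R is finitely generated as a ℤ-module and spans D as a ℚ-vector space, and call an order maximal if it is maximal with respect to inclusion among orders of D. Let R be an order of D and let O₁ and O₂ be maximal orders of D both containing R. Then the index of R in O₁ equals the index of R in O₂, i.e., the additive quotient groups O₁/R and O₂/R have the same (finite) cardinality. In other words, the index [O : R] of R in a maximal order O ⊇ R does not depend on the choice of the maximal order O. -/

import Mathlib

/-- A subring `R` of a `ℚ`-algebra `D` is an *order* if it is finitely generated as a
`ℤ`-module and spans `D` as a `ℚ`-vector space. -/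
def Subring.IsOrder (D : Type*) [Ring D] [Module ℚ D] (R : Subring D) : Prop :=
  (AddSubgroup.toIntSubmodule R.toAddSubgroup).FG ∧ Submodule.span ℚ (R : Set D) = ⊤

/-- A *maximal order* is an order that is maximal with respect to inclusion among orders. -/
def Subring.IsMaximalOrder (D : Type*) [Ring D] [Module ℚ D] (O : Subring D) : Prop :=
  O.IsOrder D ∧ ∀ O' : Subring D, O'.IsOrder D → O ≤ O' → O' = O

section SimpleRings

variable {A : Type*} [Ring A]

/-- A maximal element among the proper two-sided ideals of a ring. -/
structure Ideal.IsMaximalTwoSided (P : Ideal A) : Prop where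
  isTwoSided : P.IsTwoSided
  ne_top : P ≠ ⊤
  eq_or_eq_top : ∀ Q : Ideal A, Q.IsTwoSided → P ≤ Q → Q = P ∨ Q = ⊤

theorem Ideal.IsMaximalTwoSided.isSimpleRing_quotient {P : Ideal A} [P.IsTwoSided]
    (hP : P.IsMaximalTwoSided) : IsSimpleRing (A ⧸ P) := by
  rw [isSimpleRing_iff_isTwoSided_imp]
  refine ⟨Ideal.Quotient.nontrivial_iff.mpr hP.ne_top, fun I hI ↦ ?_⟩
  have hle : P ≤ I.comap (Ideal.Quotient.mk P) := by
    intro x hx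
    rw [Ideal.mem_comap, Ideal.Quotient.eq_zero_iff_mem.mpr hx]
    exact I.zero_mem
  have hmap := Ideal.map_comap_of_surjective _ (Ideal.Quotient.mk_surjective (I := P)) I
  refine (hP.eq_or_eq_top (I.comap (Ideal.Quotient.mk P)) inferInstance hle).imp ?_ ?_
  · intro h
    rw [← hmap, h, Ideal.map_quotient_self]
  · intro h
    rw [← hmap, h, Ideal.map_top]

theorem IsSimpleModule.isMaximalTwoSided_annihilator (S : Type*) [AddCommGroup S] [Module A S]
    [IsSimpleModule A S] [Finite S] : (Module.annihilator A S).IsMaximalTwoSided := by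
  have hnt : Nontrivial S := IsSimpleModule.nontrivial A S
  refine ⟨inferInstance, ?_, fun Q hQ hle ↦ ?_⟩
  · rw [Ne, Ideal.eq_top_iff_one, Module.mem_annihilator]
    obtain ⟨s, hs⟩ := exists_ne (0 : S)
    exact fun h ↦ hs (by simpa using h s)
  set P := Module.annihilator A S
  have hfin := Fintype.ofFinite S
  let g : A →ₗ[A] (S → S) := LinearMap.pi fun s ↦ LinearMap.toSpanSingleton A S s
  have hg : ∀ a, g a = fun s ↦ a • s := fun a ↦ rfl
  let f : (A ⧸ P) →ₗ[A] (S → S) := P.liftQ g fun a ha ↦ by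
    rw [LinearMap.mem_ker, hg]
    exact funext fun s ↦ Module.mem_annihilator.mp ha s
  have hf : Function.Injective f := by
    rw [← LinearMap.ker_eq_bot, Submodule.ker_liftQ_eq_bot']
    refine le_antisymm ?_ ?_
    · intro a ha
      rw [LinearMap.mem_ker, hg]
      exact funext fun s ↦ Module.mem_annihilator.mp ha s
    · intro a ha
      rw [LinearMap.mem_ker, hg] at ha
      exact Module.mem_annihilator.mpr fun s ↦ congrFun ha s
  have hss : IsSemisimpleModule A (A ⧸ P) := .of_injective f hf
  have hiso' : IsIsotypicOfType A (S → S) S := by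
    intro m hm
    obtain ⟨s, hs⟩ : ∃ s, (LinearMap.proj (R := A) (φ := fun _ : S ↦ S) s ∘ₗ m.subtype) ≠ 0 := by
      by_contra! h
      have := IsSimpleModule.nontrivial A m
      obtain ⟨x, hx⟩ := exists_ne (0 : m)
      exact hx (Subtype.ext (funext fun s ↦ DFunLike.congr_fun (h s) x))
    exact ⟨LinearEquiv.ofBijective _ (LinearMap.bijective_of_ne_zero hs)⟩
  have hiso : IsIsotypic A (A ⧸ P) := (hiso'.of_injective f hf).isIsotypic
  rw [isIsotypic_iff_isFullyInvariant_imp_bot_or_top] at hiso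
  refine (hiso (Submodule.map P.mkQ Q) fun e ↦ ?_).imp ?_ ?_
  · rintro _ ⟨q, hq, rfl⟩
    obtain ⟨b, hb⟩ := P.mkQ_surjective (e (P.mkQ 1))
    refine ⟨q * b, Q.mul_mem_right b hq, ?_⟩
    have : P.mkQ q = q • P.mkQ 1 := by rw [← map_smul, smul_eq_mul, mul_one]
    rw [this, map_smul, ← hb, ← map_smul, smul_eq_mul]
  · intro h
    rw [← le_bot_iff, Submodule.map_le_iff_le_comap, Submodule.comap_bot, P.ker_mkQ] at h
    exact le_antisymm h hle
  · intro h
    rw [eq_top_iff]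
    intro x _
    obtain ⟨q, hq, hqx⟩ : P.mkQ x ∈ Submodule.map P.mkQ Q := h ▸ Submodule.mem_top
    have := hle ((Submodule.Quotient.eq P).mp hqx)
    simpa using Q.sub_mem hq this

theorem IsSimpleRing.nonempty_linearEquiv (B : Type*) [Ring B] [IsSimpleRing B] [IsArtinianRing B]
    (S T : Type*) [AddCommGroup S] [AddCommGroup T] [Module B S] [Module B T]
    [IsSimpleModule B S] [IsSimpleModule B T] : Nonempty (S ≃ₗ[B] T) := by
  obtain ⟨I, ⟨e⟩⟩ := IsSemisimpleRing.exists_linearEquiv_ideal_of_isSimpleModule B S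
  obtain ⟨J, ⟨e'⟩⟩ := IsSemisimpleRing.exists_linearEquiv_ideal_of_isSimpleModule B T
  have := IsSimpleModule.congr e.symm
  have := IsSimpleModule.congr e'.symm
  obtain ⟨e''⟩ := IsSimpleRing.isIsotypic B B J I
  exact ⟨e.trans (e''.trans e'.symm)⟩

theorem IsSimpleRing.nonempty_linearEquiv_of_card_eq (B : Type*) [Ring B] [IsSimpleRing B]
    [Finite B] (N : Type*) [AddCommGroup N] [Module B N] [Finite N]
    (h : Nat.card N = Nat.card B) : Nonempty (B ≃ₗ[B] N) := by
  have hN : Nontrivial N := by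
    rw [← Finite.one_lt_card_iff_nontrivial, h]
    exact Finite.one_lt_card
  obtain ⟨n, _, S, hS, ⟨e⟩⟩ := (IsSimpleRing.isIsotypic B B).linearEquiv_fun
  obtain ⟨m, _, T, hT, ⟨e'⟩⟩ := (IsSimpleRing.isIsotypic B N).linearEquiv_fun
  obtain ⟨u⟩ := IsSimpleRing.nonempty_linearEquiv B S T
  have := IsSimpleModule.nontrivial B S
  have hcard : Nat.card S ^ m = Nat.card S ^ n := by
    have h1 := Nat.card_congr e.toEquiv
    have h2 := Nat.card_congr e'.toEquiv
    rw [Nat.card_fun, Nat.card_fin] at h1 h2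
    rw [← h1, ← h, h2, Nat.card_congr u.toEquiv]
  obtain rfl := Nat.pow_right_injective Finite.one_lt_card hcard
  exact ⟨e.trans ((LinearEquiv.piCongrRight fun _ ↦ u).trans e'.symm)⟩

theorem Ideal.IsMaximalTwoSided.card_eq_of_isSimpleModule {P : Ideal A}
    (hP : P.IsMaximalTwoSided) [Finite (A ⧸ P)] {S T : Type*} [AddCommGroup S] [AddCommGroup T]
    [Module A S] [Module A T] [IsSimpleModule A S] [IsSimpleModule A T]
    (hS : Module.IsTorsionBySet A S P) (hT : Module.IsTorsionBySet A T P) :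
    Nat.card S = Nat.card T := by
  have := hP.isTwoSided
  have := hP.isSimpleRing_quotient
  let := hS.module
  let := hT.module
  have : IsSimpleModule (A ⧸ P) S :=
    (hS.semilinearMap.isSimpleModule_iff_of_bijective Function.bijective_id).mp ‹_›
  have : IsSimpleModule (A ⧸ P) T :=
    (hT.semilinearMap.isSimpleModule_iff_of_bijective Function.bijective_id).mp ‹_›
  obtain ⟨e⟩ := IsSimpleRing.nonempty_linearEquiv (A ⧸ P) S T
  exact Nat.card_congr e.toEquiv

theorem Ideal.IsMaximalTwoSided.exists_span_singleton_eq_top {P : Ideal A}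
    (hP : P.IsMaximalTwoSided) [Finite (A ⧸ P)] {N : Type*} [AddCommGroup N] [Module A N]
    (hN : Module.IsTorsionBySet A N P) (hcard : Nat.card N = Nat.card (A ⧸ P)) :
    ∃ x : N, ∀ y : N, ∃ a : A, a • x = y := by
  have := hP.isTwoSided
  have := hP.isSimpleRing_quotient
  let := hN.module
  have : Finite N := Nat.finite_of_card_ne_zero (hcard ▸ Nat.card_pos.ne')
  obtain ⟨e⟩ := IsSimpleRing.nonempty_linearEquiv_of_card_eq (A ⧸ P) N hcard
  refine ⟨e 1, fun y ↦ ?_⟩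
  obtain ⟨a, ha⟩ := Ideal.Quotient.mk_surjective (e.symm y)
  refine ⟨a, ?_⟩
  rw [← Module.IsTorsionBySet.mk_smul hN, ← map_smul, ha, smul_eq_mul, mul_one]
  simp

end SimpleRings

section IdealProducts

variable {A : Type*} [Ring A]

/-- The ordered product of a list of ideals of a possibly noncommutative ring. -/
def Ideal.listProd (l : List (Ideal A)) : Ideal A := l.foldr (· * ·) ⊤

@[simp]
theorem Ideal.listProd_nil : Ideal.listProd ([] : List (Ideal A)) = ⊤ := rfl

@[simp]
theorem Ideal.listProd_cons (P : Ideal A) (l : List (Ideal A)) :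
    Ideal.listProd (P :: l) = P * Ideal.listProd l := rfl

theorem Ideal.listProd_append (l₁ l₂ : List (Ideal A)) :
    Ideal.listProd (l₁ ++ l₂) = Ideal.listProd l₁ * Ideal.listProd l₂ := by
  induction l₁ with
  | nil => simp
  | cons P l ih =>
    rw [List.cons_append, Ideal.listProd_cons, ih, Ideal.listProd_cons]
    exact (Submodule.smul_assoc P _ _).symm

theorem Ideal.isTwoSided_listProd {l : List (Ideal A)} (h : ∀ P ∈ l, P.IsTwoSided) :
    (Ideal.listProd l).IsTwoSided := by
  induction l with
  | nil => rw [Ideal.listProd_nil]; infer_instance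
  | cons P l ih =>
    have := ih fun Q hQ ↦ h Q (List.mem_cons_of_mem _ hQ)
    rw [Ideal.listProd_cons]
    infer_instance

theorem Ideal.listProd_le {l : List (Ideal A)} (h : ∀ P ∈ l, P.IsTwoSided) {P : Ideal A}
    (hP : P ∈ l) : Ideal.listProd l ≤ P := by
  induction l with
  | nil => simp at hP
  | cons Q l ih =>
    rw [Ideal.listProd_cons]
    rcases List.mem_cons.mp hP with rfl | hP
    · have := h P List.mem_cons_self
      exact Ideal.mul_le_left
    · exact Ideal.mul_le_right.trans (ih (fun Q hQ ↦ h Q (List.mem_cons_of_mem _ hQ)) hP)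

theorem Ideal.pow_mem_listProd {l : List (Ideal A)} {a : A} (h : ∀ P ∈ l, a ∈ P) :
    a ^ l.length ∈ Ideal.listProd l := by
  induction l with
  | nil => simp
  | cons P l ih =>
    rw [Ideal.listProd_cons, List.length_cons, pow_succ']
    exact Ideal.mul_mem_mul (h P List.mem_cons_self)
      (ih fun Q hQ ↦ h Q (List.mem_cons_of_mem _ hQ))

theorem Ideal.IsMaximalTwoSided.eq_of_le {P Q : Ideal A} (hP : P.IsMaximalTwoSided)
    (hQ : Q.IsMaximalTwoSided) (h : Q ≤ P) : Q = P :=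
  ((hQ.eq_or_eq_top P hP.isTwoSided h).resolve_right hP.ne_top).symm

theorem Ideal.IsMaximalTwoSided.sup_eq_top {P X : Ideal A} (hP : P.IsMaximalTwoSided)
    (hX : X.IsTwoSided) (h : ¬ X ≤ P) : X ⊔ P = ⊤ := by
  have := hP.isTwoSided
  have h2 : (X ⊔ P).IsTwoSided := by
    refine ⟨fun {a} b ha ↦ ?_⟩
    obtain ⟨x, hx, y, hy, rfl⟩ := Submodule.mem_sup.mp ha
    rw [add_mul]
    exact Submodule.add_mem_sup (X.mul_mem_right b hx) (P.mul_mem_right b hy)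
  refine (hP.eq_or_eq_top _ h2 le_sup_right).resolve_left fun h' ↦ h ?_
  rw [← h']
  exact le_sup_left

theorem Ideal.IsMaximalTwoSided.le_or_le_of_mul_le {P X Y : Ideal A} (hP : P.IsMaximalTwoSided)
    (hX : X.IsTwoSided) (h : X * Y ≤ P) : X ≤ P ∨ Y ≤ P := by
  have := hP.isTwoSided
  by_contra! hXY
  refine hXY.2 ?_
  have htop : (⊤ : Ideal A) * Y = Y := Submodule.top_smul Y
  rw [← htop, ← hP.sup_eq_top hX hXY.1, Ideal.sup_mul]
  exact sup_le h Ideal.mul_le_left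

theorem Ideal.IsMaximalTwoSided.mem_of_listProd_le {P : Ideal A} (hP : P.IsMaximalTwoSided)
    {l : List (Ideal A)} (hl : ∀ Q ∈ l, Q.IsMaximalTwoSided) (h : Ideal.listProd l ≤ P) :
    P ∈ l := by
  induction l with
  | nil => exact absurd (top_le_iff.mp h) hP.ne_top
  | cons Q l ih =>
    have hQ := hl Q List.mem_cons_self
    rcases hP.le_or_le_of_mul_le hQ.isTwoSided h with h | h
    · rw [hP.eq_of_le hQ h]
      exact List.mem_cons_self
    · exact List.mem_cons_of_mem _ (ih (fun Q hQ ↦ hl Q (List.mem_cons_of_mem _ hQ)) h)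

variable {V : Type*} [AddCommGroup V] [Module A V]

theorem Submodule.le_span_singleton_sup_of_sub_mem {M N : Submodule A V} {x y : V}
    (h : M ≤ Submodule.span A {x} ⊔ N) (hxy : x - y ∈ N) : M ≤ Submodule.span A {y} ⊔ N := by
  refine h.trans (sup_le ?_ le_sup_right)
  rw [Submodule.span_singleton_le_iff_mem, ← sub_add_cancel x y]
  exact add_mem (Submodule.mem_sup_right hxy)
    (Submodule.mem_sup_left (Submodule.mem_span_singleton_self y))

theorem Submodule.exists_forall_le_span_singleton_sup_smul {M : Submodule A V}
    {l : List (Ideal A)} (hl : ∀ P ∈ l, P.IsMaximalTwoSided)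
    (h : ∀ P ∈ l, ∃ x ∈ M, M ≤ Submodule.span A {x} ⊔ P • M) :
    ∃ x ∈ M, ∀ P ∈ l, M ≤ Submodule.span A {x} ⊔ P • M := by
  induction l with
  | nil => exact ⟨0, M.zero_mem, by simp⟩
  | cons P l ih =>
    have hl' : ∀ Q ∈ l, Q.IsMaximalTwoSided := fun Q hQ ↦ hl Q (List.mem_cons_of_mem _ hQ)
    obtain ⟨x, hxM, hx⟩ := ih hl' fun Q hQ ↦ h Q (List.mem_cons_of_mem _ hQ)
    by_cases hPl : P ∈ l
    · refine ⟨x, hxM, fun Q hQ ↦ ?_⟩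
      rcases List.mem_cons.mp hQ with rfl | hQ
      exacts [hx _ hPl, hx _ hQ]
    have hP := hl P List.mem_cons_self
    obtain ⟨y, hyM, hy⟩ := h P List.mem_cons_self
    have htwo : ∀ Q ∈ l, Q.IsTwoSided := fun Q hQ ↦ (hl' Q hQ).isTwoSided
    have htop := hP.sup_eq_top (Ideal.isTwoSided_listProd htwo)
      fun h' ↦ hPl (hP.mem_of_listProd_le hl' h')
    obtain ⟨c, hc, d, hd, hcd⟩ := Submodule.mem_sup.mp ((Ideal.eq_top_iff_one _).mp htop)
    have hsub := M.sub_mem hyM hxM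
    refine ⟨x + c • (y - x), M.add_mem hxM (M.smul_mem c hsub), fun Q hQ ↦ ?_⟩
    rcases List.mem_cons.mp hQ with rfl | hQ
    · refine Submodule.le_span_singleton_sup_of_sub_mem hy ?_
      have : y - (x + c • (y - x)) = d • (y - x) := by
        rw [← eq_sub_iff_add_eq'] at hcd
        rw [hcd, sub_smul, one_smul]
        abel
      rw [this]
      exact Submodule.smul_mem_smul hd hsub
    · refine Submodule.le_span_singleton_sup_of_sub_mem (hx Q hQ) ?_
      have : x - (x + c • (y - x)) = -(c • (y - x)) := by abel
      rw [this]
      exact neg_mem (Submodule.smul_mem_smul (Ideal.listProd_le htwo hQ hc) hsub)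

theorem Submodule.le_sup_listProd_smul {M N : Submodule A V} {l : List (Ideal A)}
    (h : ∀ P ∈ l, M ≤ N ⊔ P • M) : M ≤ N ⊔ Ideal.listProd l • M := by
  induction l with
  | nil => simp
  | cons P l ih =>
    have ih := ih fun Q hQ ↦ h Q (List.mem_cons_of_mem _ hQ)
    have hP := h P List.mem_cons_self
    refine hP.trans (sup_le le_sup_left ?_)
    refine (Submodule.smul_mono le_rfl ih).trans ?_
    rw [Submodule.smul_sup, Ideal.listProd_cons]
    refine sup_le (Submodule.smul_le_right.trans le_sup_left) ?_
    exact (Submodule.smul_assoc P _ _).symm.le.trans le_sup_right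

end IdealProducts

section Indices

variable {A : Type*} [Ring A] {V : Type*} [AddCommGroup V] [Module A V]

theorem Submodule.relIndex_eq_card_quotient (N M : Submodule A V) :
    N.toAddSubgroup.relIndex M.toAddSubgroup = Nat.card (M ⧸ N.comap M.subtype) := rfl

/-- Induction along a chain of covering submodules above a submodule of finite index. -/
theorem Submodule.covBy_induction {M' M : Submodule A V} (hle : M' ≤ M)
    (hfin : M'.toAddSubgroup.relIndex M.toAddSubgroup ≠ 0) {C : Submodule A V → Prop}
    (base : C M')
    (step : ∀ N K : Submodule A V, M' ≤ N → N ⋖ K → K ≤ M →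
      N.toAddSubgroup.relIndex K.toAddSubgroup ≠ 0 → C N → C K) : C M := by
  induction hn : M'.toAddSubgroup.relIndex M.toAddSubgroup using Nat.strong_induction_on
    generalizing M with
  | _ n ih =>
  rcases hle.eq_or_lt with rfl | hlt
  · exact base
  have mul : ∀ {X Y Z : Submodule A V}, X ≤ Y → Y ≤ Z →
      X.toAddSubgroup.relIndex Y.toAddSubgroup * Y.toAddSubgroup.relIndex Z.toAddSubgroup =
        X.toAddSubgroup.relIndex Z.toAddSubgroup :=
    fun hXY hYZ ↦ AddSubgroup.relIndex_mul_relIndex _ _ _ hXY hYZ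
  have ne_one : ∀ {X Y : Submodule A V}, X < Y →
      X.toAddSubgroup.relIndex Y.toAddSubgroup ≠ 1 :=
    fun hXY h ↦ hXY.not_ge (AddSubgroup.relIndex_eq_one.mp h)
  obtain ⟨N, ⟨hM'N, hNM⟩, hmin⟩ := WellFounded.has_min
    (measure fun N : Submodule A V ↦ N.toAddSubgroup.relIndex M.toAddSubgroup).wf
    {N | M' ≤ N ∧ N < M} ⟨M', le_rfl, hlt⟩
  have hmulN := mul hM'N hNM.le
  have h0 : M'.toAddSubgroup.relIndex N.toAddSubgroup ≠ 0 := fun h ↦ hfin (by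
    rw [← hmulN, h, zero_mul])
  have h1 : N.toAddSubgroup.relIndex M.toAddSubgroup ≠ 0 := fun h ↦ hfin (by
    rw [← hmulN, h, mul_zero])
  have hcov : N ⋖ M := by
    refine ⟨hNM, fun K hNK hKM ↦ hmin K ⟨hM'N.trans hNK.le, hKM⟩ ?_⟩
    have hmulK := mul hNK.le hKM.le
    have hK0 : N.toAddSubgroup.relIndex K.toAddSubgroup ≠ 0 := fun h ↦ h1 (by
      rw [← hmulK, h, zero_mul])
    have hK1 : K.toAddSubgroup.relIndex M.toAddSubgroup ≠ 0 := fun h ↦ h1 (by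
      rw [← hmulK, h, mul_zero])
    have := ne_one hNK
    change K.toAddSubgroup.relIndex M.toAddSubgroup < N.toAddSubgroup.relIndex M.toAddSubgroup
    rw [← hmulK]
    exact lt_mul_left (Nat.pos_of_ne_zero hK1) (by omega)
  refine step N M hM'N hcov le_rfl h1 (ih _ ?_ hM'N h0 ?_ rfl)
  · rw [← hn, ← hmulN]
    have := ne_one hNM
    exact lt_mul_right (Nat.pos_of_ne_zero h0) (by omega)
  · exact fun X Y h h' h'' ↦ step X Y h h' (h''.trans hNM.le)

theorem Submodule.exists_listProd_smul_le {M' M : Submodule A V} (hle : M' ≤ M)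
    (hfin : M'.toAddSubgroup.relIndex M.toAddSubgroup ≠ 0) {a : A} (ha : ∀ x ∈ M, a • x ∈ M') :
    ∃ l : List (Ideal A), (∀ P ∈ l, P.IsMaximalTwoSided ∧ a ∈ P) ∧
      Ideal.listProd l • M ≤ M' := by
  refine Submodule.covBy_induction (C := fun M ↦ ∃ l : List (Ideal A),
    (∀ P ∈ l, P.IsMaximalTwoSided ∧ a ∈ P) ∧ Ideal.listProd l • M ≤ M') hle hfin
    ⟨[], by simp, by simp⟩ fun N K hN hNK hKM hidx ⟨l, hl, hle⟩ ↦ ?_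
  rw [Submodule.relIndex_eq_card_quotient] at hidx
  have := (covBy_iff_quot_is_simple hNK.le).mp hNK
  have : Finite (K ⧸ N.comap K.subtype) := Nat.finite_of_card_ne_zero hidx
  have hann : ∀ b, b ∈ Module.annihilator A (K ⧸ N.comap K.subtype) ↔ ∀ x ∈ K, b • x ∈ N := by
    intro b
    rw [Module.mem_annihilator]
    refine ⟨fun h x hx ↦ ?_, fun h y ↦ ?_⟩
    · simpa using (Submodule.Quotient.mk_eq_zero _).mp (h (Submodule.Quotient.mk ⟨x, hx⟩))
    · obtain ⟨y, rfl⟩ := Submodule.Quotient.mk_surjective _ y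
      rw [← Submodule.Quotient.mk_smul, Submodule.Quotient.mk_eq_zero]
      exact h y y.2
  refine ⟨l ++ [Module.annihilator A (K ⧸ N.comap K.subtype)], fun P hP ↦ ?_, ?_⟩
  · rcases List.mem_append.mp hP with hP | hP
    · exact hl P hP
    · rw [List.mem_singleton.mp hP]
      exact ⟨IsSimpleModule.isMaximalTwoSided_annihilator _,
        (hann a).mpr fun x hx ↦ hN (ha x (hKM hx))⟩
  · rw [Ideal.listProd_append, Ideal.listProd_cons, Ideal.listProd_nil]
    have : (Module.annihilator A (K ⧸ N.comap K.subtype) * ⊤) • K ≤ N := by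
      refine Submodule.smul_le.mpr fun b hb x hx ↦ (hann b).mp (Ideal.mul_le_left hb) x hx
    refine le_trans ?_ hle
    refine (Submodule.smul_assoc _ _ _).le.trans (Submodule.smul_mono le_rfl this)

/-- Multiplication by an ideal which permutes the submodules of `V` preserves finite indices. -/
theorem Ideal.IsMaximalTwoSided.relIndex_smul {P : Ideal A} (hP : P.IsMaximalTwoSided)
    [Finite (A ⧸ P)] (e : Submodule A V ≃o Submodule A V) (he : ∀ M, e M = P • M)
    {M' M : Submodule A V} (hle : M' ≤ M)
    (hfin : M'.toAddSubgroup.relIndex M.toAddSubgroup ≠ 0) :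
    (P • M').toAddSubgroup.relIndex (P • M).toAddSubgroup =
      M'.toAddSubgroup.relIndex M.toAddSubgroup := by
  have hPle : ∀ {M N : Submodule A V}, M ≤ N → P • M ≤ P • N := fun h ↦
    Submodule.smul_mono le_rfl h
  refine Submodule.covBy_induction (C := fun M ↦
    (P • M').toAddSubgroup.relIndex (P • M).toAddSubgroup =
      M'.toAddSubgroup.relIndex M.toAddSubgroup) hle hfin (by simp)
    fun N K hN hNK _ hidx ih ↦ ?_
  rw [← AddSubgroup.relIndex_mul_relIndex (P • M').toAddSubgroup (P • N).toAddSubgroup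
    (P • K).toAddSubgroup (hPle hN) (hPle hNK.le),
    ← AddSubgroup.relIndex_mul_relIndex M'.toAddSubgroup N.toAddSubgroup K.toAddSubgroup
      hN hNK.le, ih]
  congr 1
  have hcov : P • N ⋖ P • K := by
    rw [← he, ← he]
    exact (apply_covBy_apply_iff e).mpr hNK
  by_cases hPK : P • K ≤ N
  · have := (covBy_iff_quot_is_simple hNK.le).mp hNK
    have := (covBy_iff_quot_is_simple hcov.le).mp hcov
    rw [Submodule.relIndex_eq_card_quotient, Submodule.relIndex_eq_card_quotient]
    have htors : ∀ {X Y : Submodule A V}, P • Y ≤ X →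
        Module.IsTorsionBySet A (Y ⧸ X.comap Y.subtype) P := by
      intro X Y h y b
      obtain ⟨y, rfl⟩ := Submodule.Quotient.mk_surjective _ y
      rw [← Submodule.Quotient.mk_smul, Submodule.Quotient.mk_eq_zero]
      exact h (Submodule.smul_mem_smul b.2 y.2)
    exact hP.card_eq_of_isSimpleModule (htors (Submodule.smul_mono le_rfl hPK)) (htors hPK)
  · have hinf : P • K ⊓ N = P • N := by
      refine (hcov.eq_or_eq (le_inf hcov.le Submodule.smul_le_right) inf_le_left).resolve_right ?_
      exact fun h ↦ hPK (inf_eq_left.mp h)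
    have hsup : P • K ⊔ N = K := by
      refine (hNK.eq_or_eq le_sup_right (sup_le Submodule.smul_le_right hNK.le)).resolve_left ?_
      exact fun h ↦ hPK (sup_eq_right.mp h)
    have h1 := AddSubgroup.relIndex_sup_right (P • K).toAddSubgroup N.toAddSubgroup
    have h2 := AddSubgroup.inf_relIndex_left (P • K).toAddSubgroup N.toAddSubgroup
    have h3 : (P • K ⊓ N).toAddSubgroup = (P • K).toAddSubgroup ⊓ N.toAddSubgroup := rfl
    have h4 : (P • K ⊔ N).toAddSubgroup = (P • K).toAddSubgroup ⊔ N.toAddSubgroup :=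
      Submodule.sup_toAddSubgroup _ _
    rw [hinf] at h3
    rw [hsup] at h4
    rw [h3, h4, h2, h1]

end Indices

section FiniteIndex

theorem AddSubgroup.relIndex_ne_zero_of_nsmul_mem {E : Type*} [AddCommGroup E]
    {H K : AddSubgroup E} (hK : (AddSubgroup.toIntSubmodule K).FG) {n : ℕ} (hn : n ≠ 0)
    (h : ∀ x ∈ K, n • x ∈ H) : H.relIndex K ≠ 0 := by
  have : Module.Finite ℤ K := Module.Finite.iff_fg.mpr hK
  have : AddGroup.FG K := Module.Finite.iff_addGroup_fg.mp this
  have htors : IsAddTorsion (K ⧸ H.addSubgroupOf K) := by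
    intro y
    obtain ⟨x, rfl⟩ := QuotientAddGroup.mk_surjective y
    rw [isOfFinAddOrder_iff_nsmul_eq_zero]
    refine ⟨n, Nat.pos_of_ne_zero hn, ?_⟩
    rw [← QuotientAddGroup.mk_nsmul, QuotientAddGroup.eq_zero_iff]
    exact h x x.2
  have := AddCommGroup.finite_of_fg_isAddTorsion _ htors
  exact Nat.card_pos.ne'

end FiniteIndex

section Orders

variable {D : Type*} [Ring D] [Algebra ℚ D]

theorem Subring.IsOrder.exists_nsmul_mem {R : Subring D} (hR : R.IsOrder D) (d : D) :
    ∃ n : ℕ, n ≠ 0 ∧ n • d ∈ R := by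
  have hd : d ∈ Submodule.span ℚ (R : Set D) := hR.2 ▸ Submodule.mem_top
  induction hd using Submodule.span_induction with
  | mem x hx => exact ⟨1, one_ne_zero, by simpa using hx⟩
  | zero => exact ⟨1, one_ne_zero, by simp [R.zero_mem]⟩
  | add x y _ _ hx hy =>
    obtain ⟨n, hn, hnx⟩ := hx
    obtain ⟨m, hm, hmy⟩ := hy
    refine ⟨n * m, mul_ne_zero hn hm, ?_⟩
    rw [smul_add, mul_comm, mul_smul, mul_comm, mul_smul]
    exact R.add_mem (R.nsmul_mem hnx m) (R.nsmul_mem hmy n)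
  | smul q x _ hx =>
    obtain ⟨n, hn, hnx⟩ := hx
    refine ⟨q.den * n, mul_ne_zero q.den_nz hn, ?_⟩
    have : (q.den * n) • q • x = q.num • n • x := by
      rw [mul_comm, mul_smul, ← Nat.cast_smul_eq_nsmul ℚ q.den, smul_smul, Rat.den_mul_eq_num,
        Int.cast_smul_eq_zsmul, smul_comm]
    rw [this]
    exact R.zsmul_mem hnx _

theorem Subring.IsOrder.exists_forall_nsmul_mem {R : Subring D} (hR : R.IsOrder D)
    {M : Submodule ℤ D} (hM : M.FG) : ∃ n : ℕ, n ≠ 0 ∧ ∀ x ∈ M, n • x ∈ R := by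
  obtain ⟨s, rfl⟩ := hM
  choose f hf0 hf using hR.exists_nsmul_mem
  refine ⟨∏ i ∈ s, f i, Finset.prod_ne_zero_iff.mpr fun i _ ↦ hf0 i, fun x hx ↦ ?_⟩
  induction hx using Submodule.span_induction with
  | mem x hx =>
    obtain ⟨c, hc⟩ := Finset.dvd_prod_of_mem f hx
    rw [hc, mul_comm, mul_smul]
    exact R.nsmul_mem (hf x) c
  | zero => simp [R.zero_mem]
  | add x y _ _ hx hy => rw [smul_add]; exact R.add_mem hx hy
  | smul a x _ hx => rw [smul_comm]; exact R.zsmul_mem hx a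

theorem Subring.fg_of_nsmul_mem {O : Subring D} (hO : O.IsOrder D) {H : AddSubgroup D} {n : ℕ}
    (hn : n ≠ 0) (h : ∀ x ∈ H, n • x ∈ O) : (AddSubgroup.toIntSubmodule H).FG := by
  have hnoeth : IsNoetherian ℤ (AddSubgroup.toIntSubmodule O.toAddSubgroup) :=
    isNoetherian_of_fg_of_noetherian _ hO.1
  have hinj : Function.Injective ((n : ℤ) • (LinearMap.id : D →ₗ[ℤ] D)) := by
    intro x y hxy
    have hxy : (n : ℤ) • x = (n : ℤ) • y := hxy
    rw [← Int.cast_smul_eq_zsmul ℚ, ← Int.cast_smul_eq_zsmul ℚ (n : ℤ) y] at hxy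
    exact (smul_right_inj (by exact_mod_cast hn)).mp hxy
  refine Submodule.fg_of_fg_map_injective _ hinj ?_
  have hle : (AddSubgroup.toIntSubmodule H).map ((n : ℤ) • (LinearMap.id : D →ₗ[ℤ] D)) ≤
      AddSubgroup.toIntSubmodule O.toAddSubgroup := by
    rintro _ ⟨x, hx, rfl⟩
    change (n : ℤ) • x ∈ O
    rw [natCast_zsmul]
    exact h x hx
  have := (isNoetherian_submodule.mp hnoeth) _ hle
  exact this

theorem Subring.IsMaximalOrder.mem_of_nsmul_mem {O S : Subring D} (hO : O.IsMaximalOrder D)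
    (hOS : O ≤ S) {n : ℕ} (hn : n ≠ 0) (h : ∀ x ∈ S, n • x ∈ O) {d : D} (hd : d ∈ S) : d ∈ O := by
  have hS : S.IsOrder D := by
    refine ⟨Subring.fg_of_nsmul_mem hO.1 hn h, ?_⟩
    rw [eq_top_iff, ← hO.1.2]
    exact Submodule.span_mono hOS
  rwa [hO.2 S hS hOS] at hd

theorem Subring.IsMaximalOrder.mem_of_forall_mul_mem {O : Subring D} (hO : O.IsMaximalOrder D)
    (X : Ideal O) {n : ℕ} (hn : n ≠ 0) (hnX : (n : O) ∈ X) {d : D}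
    (hd : ∀ x ∈ X, ∃ y ∈ X, d * (x : D) = y) : d ∈ O := by
  let S : Subring D :=
    { carrier := {d | ∀ x ∈ X, ∃ y ∈ X, d * (x : D) = y}
      mul_mem' := by
        intro a b ha hb x hx
        obtain ⟨y, hy, hxy⟩ := hb x hx
        obtain ⟨z, hz, hyz⟩ := ha y hy
        exact ⟨z, hz, by rw [mul_assoc, hxy, hyz]⟩
      one_mem' := fun x hx ↦ ⟨x, hx, one_mul _⟩
      add_mem' := by
        intro a b ha hb x hx
        obtain ⟨y, hy, hxy⟩ := ha x hx
        obtain ⟨z, hz, hxz⟩ := hb x hx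
        exact ⟨y + z, X.add_mem hy hz, by rw [add_mul, hxy, hxz]; rfl⟩
      zero_mem' := fun x _ ↦ ⟨0, X.zero_mem, by simp⟩
      neg_mem' := by
        intro a ha x hx
        obtain ⟨y, hy, hxy⟩ := ha x hx
        exact ⟨-y, X.neg_mem hy, by rw [neg_mul, hxy]; rfl⟩ }
  refine hO.mem_of_nsmul_mem (S := S) ?_ hn ?_ hd
  · exact fun a ha x hx ↦ ⟨⟨a, ha⟩ * x, X.mul_mem_left _ hx, rfl⟩
  · intro x hx
    obtain ⟨y, hy, hxy⟩ := hx _ hnX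
    rw [nsmul_eq_mul, Nat.cast_comm]
    have : x * (n : D) = y := by simpa using hxy
    rw [this]
    exact y.2

theorem Subring.IsMaximalOrder.mem_of_forall_mem_mul {O : Subring D} (hO : O.IsMaximalOrder D)
    (X : Ideal O) [X.IsTwoSided] {n : ℕ} (hn : n ≠ 0) (hnX : (n : O) ∈ X) {d : D}
    (hd : ∀ x ∈ X, ∃ y ∈ X, (x : D) * d = y) : d ∈ O := by
  let S : Subring D :=
    { carrier := {d | ∀ x ∈ X, ∃ y ∈ X, (x : D) * d = y}
      mul_mem' := by
        intro a b ha hb x hx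
        obtain ⟨y, hy, hxy⟩ := ha x hx
        obtain ⟨z, hz, hyz⟩ := hb y hy
        exact ⟨z, hz, by rw [← mul_assoc, hxy, hyz]⟩
      one_mem' := fun x hx ↦ ⟨x, hx, mul_one _⟩
      add_mem' := by
        intro a b ha hb x hx
        obtain ⟨y, hy, hxy⟩ := ha x hx
        obtain ⟨z, hz, hxz⟩ := hb x hx
        exact ⟨y + z, X.add_mem hy hz, by rw [mul_add, hxy, hxz]; rfl⟩
      zero_mem' := fun x _ ↦ ⟨0, X.zero_mem, by simp⟩
      neg_mem' := by
        intro a ha x hx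
        obtain ⟨y, hy, hxy⟩ := ha x hx
        exact ⟨-y, X.neg_mem hy, by rw [mul_neg, hxy]; rfl⟩ }
  refine hO.mem_of_nsmul_mem (S := S) ?_ hn ?_ hd
  · exact fun a ha x hx ↦ ⟨x * ⟨a, ha⟩, X.mul_mem_right _ hx, rfl⟩
  · intro x hx
    obtain ⟨y, hy, hxy⟩ := hx _ hnX
    rw [nsmul_eq_mul]
    have : (n : D) * x = y := by simpa using hxy
    rw [this]
    exact y.2

theorem Subring.IsOrder.relIndex_ideal_ne_zero {O : Subring D} (hO : O.IsOrder D) {n : ℕ}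
    (hn : n ≠ 0) (X : Ideal O) (hnX : (n : O) ∈ X) :
    X.toAddSubgroup.relIndex (⊤ : Ideal O).toAddSubgroup ≠ 0 := by
  refine AddSubgroup.relIndex_ne_zero_of_nsmul_mem ?_ hn fun x _ ↦ ?_
  · have : Module.Finite ℤ O := Module.Finite.iff_fg.mpr hO.1
    exact Module.Finite.fg_top (R := ℤ) (M := O)
  · rw [nsmul_eq_mul, Nat.cast_comm]
    exact X.mul_mem_left x hnX

theorem Subring.IsOrder.finite_quotient {O : Subring D} (hO : O.IsOrder D) {n : ℕ}
    (hn : n ≠ 0) (X : Ideal O) (hnX : (n : O) ∈ X) : Finite (O ⧸ X) := by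
  have h := hO.relIndex_ideal_ne_zero hn X hnX
  have h' : X.toAddSubgroup.relIndex (⊤ : Ideal O).toAddSubgroup = X.toAddSubgroup.index :=
    AddSubgroup.relIndex_top_right _
  rw [h'] at h
  exact Nat.finite_of_card_ne_zero h

theorem Subring.IsOrder.exists_listProd_le {O : Subring D} (hO : O.IsOrder D) {n : ℕ}
    (hn : n ≠ 0) : ∃ l : List (Ideal O), (∀ P ∈ l, P.IsMaximalTwoSided ∧ (n : O) ∈ P) ∧
      Ideal.listProd l ≤ Ideal.span {(n : O)} := by
  have hmem : (n : O) ∈ Ideal.span {(n : O)} := Ideal.mem_span_singleton_self _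
  obtain ⟨l, hl, hle⟩ := Submodule.exists_listProd_smul_le (le_top (a := Ideal.span {(n : O)}))
    (hO.relIndex_ideal_ne_zero hn _ hmem) (a := (n : O)) fun x _ ↦ by
      rw [smul_eq_mul, Nat.cast_comm]
      exact Ideal.mul_mem_left _ x hmem
  refine ⟨l, hl, le_trans (fun x hx ↦ ?_) hle⟩
  have := Submodule.smul_mem_smul hx (Submodule.mem_top (R := O) (x := (1 : O)))
  rwa [smul_eq_mul (a := x), mul_one] at this

/-- A maximal two-sided ideal of a maximal order has a fractional inverse strictly larger than
the order. -/
theorem Subring.IsMaximalOrder.exists_notMem_forall_mul_mem {O : Subring D}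
    (hO : O.IsMaximalOrder D) {n : ℕ} (hn : n ≠ 0) {P : Ideal O} (hP : P.IsMaximalTwoSided)
    (hnP : (n : O) ∈ P) : ∃ w : D, w ∉ O ∧ ∀ q ∈ P, w * (q : D) ∈ O := by
  obtain ⟨l, ⟨hl, hle⟩, hmin⟩ := WellFounded.has_min (measure (List.length (α := Ideal O))).wf
    {l | (∀ P ∈ l, P.IsMaximalTwoSided ∧ (n : O) ∈ P) ∧
      Ideal.listProd l ≤ Ideal.span {(n : O)}} (hO.1.exists_listProd_le hn)
  have hPl : P ∈ l := by
    refine hP.mem_of_listProd_le (fun Q hQ ↦ (hl Q hQ).1) (hle.trans ?_)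
    rwa [Ideal.span_singleton_le_iff_mem]
  obtain ⟨l₁, l₂, rfl⟩ := List.append_of_mem hPl
  have hl₂ : ∀ Q ∈ l₂, Q.IsMaximalTwoSided ∧ (n : O) ∈ Q := fun Q hQ ↦ hl Q (by simp [hQ])
  have hl₁ : ∀ Q ∈ l₁, Q.IsMaximalTwoSided ∧ (n : O) ∈ Q := fun Q hQ ↦ hl Q (by simp [hQ])
  have hnot : ¬ Ideal.listProd (l₂ ++ l₁) ≤ Ideal.span {(n : O)} := by
    refine fun h ↦ hmin (l₂ ++ l₁) ⟨fun Q hQ ↦ ?_, h⟩ ?_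
    · exact (List.mem_append.mp hQ).elim (hl₂ Q) (hl₁ Q)
    · change (l₂ ++ l₁).length < (l₁ ++ P :: l₂).length
      simp only [List.length_append, List.length_cons]
      omega
  obtain ⟨c, hc, hcn⟩ := SetLike.not_le_iff_exists.mp hnot
  have hnQ : (n : ℚ) ≠ 0 := by exact_mod_cast hn
  have : (Ideal.listProd l₂).IsTwoSided :=
    Ideal.isTwoSided_listProd fun Q hQ ↦ (hl₂ Q hQ).1.isTwoSided
  refine ⟨(n : ℚ)⁻¹ • (c : D), fun hw ↦ hcn ?_, fun q hq ↦ ?_⟩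
  · rw [Ideal.mem_span_singleton']
    refine ⟨⟨_, hw⟩, Subtype.ext ?_⟩
    change (n : ℚ)⁻¹ • (c : D) * ((n : O) : D) = c
    rw [Subring.coe_natCast, ← Nat.cast_comm, ← nsmul_eq_mul, ← Nat.cast_smul_eq_nsmul ℚ,
      smul_inv_smul₀ hnQ]
  · refine hO.mem_of_forall_mul_mem (Ideal.listProd l₂) (pow_ne_zero l₂.length hn) ?_
      fun x hx ↦ ?_
    · rw [Nat.cast_pow]
      exact Ideal.pow_mem_listProd fun Q hQ ↦ (hl₂ Q hQ).2
    · have hmem : c * (q * x) ∈ Ideal.listProd l₂ * Ideal.span {(n : O)} := by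
        refine Ideal.mul_mono le_rfl hle ?_
        have h1 := Submodule.smul_mem_smul hc (Ideal.mul_mem_mul hq hx)
        rw [Ideal.listProd_append] at h1
        rw [Ideal.listProd_append, Ideal.listProd_cons]
        exact (Submodule.smul_assoc _ _ _).le h1
      obtain ⟨z, hz, hzn⟩ := Ideal.mem_mul_span_singleton.mp hmem
      refine ⟨z, hz, ?_⟩
      have h2 : (c : D) * (q * x) = (n : ℚ) • (z : D) := by
        have := congrArg (Subtype.val) hzn
        rw [Nat.cast_smul_eq_nsmul, nsmul_eq_mul, Nat.cast_comm]
        exact this.symm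
      rw [smul_mul_assoc, smul_mul_assoc, mul_assoc, h2, inv_smul_smul₀ hnQ]

/-- Multiplication by a maximal two-sided ideal of a maximal order permutes the submodules of the
ambient algebra. -/
theorem Subring.IsMaximalOrder.exists_orderIso {O : Subring D}
    (hO : O.IsMaximalOrder D) {n : ℕ} (hn : n ≠ 0) {P : Ideal O} (hP : P.IsMaximalTwoSided)
    (hnP : (n : O) ∈ P) : ∃ e : Submodule O D ≃o Submodule O D, ∀ M, e M = P • M := by
  have := hP.isTwoSided
  obtain ⟨w₀, hw₀, hw₀P⟩ := hO.exists_notMem_forall_mul_mem hn hP hnP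
  let W : Set D := {w | ∀ q ∈ P, w * (q : D) ∈ O}
  have hone : (1 : D) ∈ W := fun q _ ↦ by rw [one_mul]; exact q.2
  have hWmul : ∀ w ∈ W, ∀ a : O, w * (a : D) ∈ W := fun w hw a q hq ↦ by
    rw [mul_assoc]
    exact hw (a * q) (P.mul_mem_left a hq)
  have hmulW : ∀ w ∈ W, ∀ a : O, (a : D) * w ∈ W := fun w hw a q hq ↦ by
    rw [mul_assoc]
    exact O.mul_mem a.2 (hw q hq)
  have hPW : ∀ w ∈ W, ∀ q ∈ P, (q : D) * w ∈ O := fun w hw q hq ↦ by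
    refine hO.mem_of_forall_mul_mem P hn hnP fun x hx ↦ ?_
    exact ⟨q * ⟨w * x, hw x hx⟩, P.mul_mem_right _ hq, mul_assoc _ _ _⟩
  have key : ∀ G : Set D, (∀ q ∈ P, (q : D) ∈ G) → (∀ g ∈ G, ∀ a : O, (a : D) * g ∈ G) →
      (∀ g ∈ G, ∀ a : O, g * (a : D) ∈ G) →
      (¬ ∀ a : O, (a : D) ∈ AddSubgroup.closure G → a ∈ P) → (1 : D) ∈ AddSubgroup.closure G := by
    intro G hPG hleft hright hnot
    have hleft' : ∀ g ∈ AddSubgroup.closure G, ∀ a : O, (a : D) * g ∈ AddSubgroup.closure G := by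
      intro g hg a
      induction hg using AddSubgroup.closure_induction with
      | mem g hg => exact AddSubgroup.subset_closure (hleft g hg a)
      | zero => rw [mul_zero]; exact zero_mem _
      | add x y _ _ hx hy => rw [mul_add]; exact add_mem hx hy
      | neg x _ hx => rw [mul_neg]; exact neg_mem hx
    have hright' : ∀ g ∈ AddSubgroup.closure G, ∀ a : O, g * (a : D) ∈ AddSubgroup.closure G := by
      intro g hg a
      induction hg using AddSubgroup.closure_induction with
      | mem g hg => exact AddSubgroup.subset_closure (hright g hg a)
      | zero => rw [zero_mul]; exact zero_mem _
      | add x y _ _ hx hy => rw [add_mul]; exact add_mem hx hy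
      | neg x _ hx => rw [neg_mul]; exact neg_mem hx
    let T : Ideal O :=
      { carrier := {a | (a : D) ∈ AddSubgroup.closure G}
        add_mem' := fun ha hb ↦ (AddSubgroup.closure G).add_mem ha hb
        zero_mem' := zero_mem (AddSubgroup.closure G)
        smul_mem' := fun a x hx ↦ hleft' x hx a }
    have hT : T.IsTwoSided := ⟨fun {a} b ha ↦ hright' a ha b⟩
    rcases hP.eq_or_eq_top T hT fun q hq ↦ AddSubgroup.subset_closure (hPG q hq) with h | h
    · exact absurd (fun a ha ↦ h ▸ (show a ∈ T from ha)) hnot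
    · exact (Ideal.eq_top_iff_one T).mp h
  have hWP : (1 : D) ∈ AddSubgroup.closure {d | ∃ w ∈ W, ∃ q ∈ P, w * (q : D) = d} := by
    refine key _ (fun q hq ↦ ⟨1, hone, q, hq, one_mul _⟩) ?_ ?_ fun h ↦ hw₀ ?_
    · rintro _ ⟨w, hw, q, hq, rfl⟩ a
      exact ⟨a * w, hmulW w hw a, q, hq, mul_assoc _ _ _⟩
    · rintro _ ⟨w, hw, q, hq, rfl⟩ a
      exact ⟨w, hw, q * a, P.mul_mem_right a hq, (mul_assoc _ _ _).symm⟩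
    · refine hO.mem_of_forall_mul_mem P hn hnP fun x hx ↦ ?_
      exact ⟨⟨w₀ * x, hw₀P x hx⟩,
        h _ (AddSubgroup.subset_closure ⟨w₀, hw₀P, x, hx, rfl⟩), rfl⟩
  have hPW' : (1 : D) ∈ AddSubgroup.closure {d | ∃ q ∈ P, ∃ w ∈ W, (q : D) * w = d} := by
    refine key _ (fun q hq ↦ ⟨q, hq, 1, hone, mul_one _⟩) ?_ ?_ fun h ↦ hw₀ ?_
    · rintro _ ⟨q, hq, w, hw, rfl⟩ a
      exact ⟨a * q, P.mul_mem_left a hq, w, hw, mul_assoc _ _ _⟩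
    · rintro _ ⟨q, hq, w, hw, rfl⟩ a
      exact ⟨q, hq, w * a, hWmul w hw a, (mul_assoc _ _ _).symm⟩
    · refine hO.mem_of_forall_mem_mul P hn hnP fun x hx ↦ ?_
      exact ⟨⟨x * w₀, hPW w₀ hw₀P x hx⟩,
        h _ (AddSubgroup.subset_closure ⟨x, hx, w₀, hw₀P, rfl⟩), rfl⟩
  have hmem : ∀ (G : Set D) (N : Submodule O D) (d : D), (1 : D) ∈ AddSubgroup.closure G →
      (∀ g ∈ G, g * d ∈ N) → d ∈ N := by
    intro G N d h1 h
    have : ∀ g ∈ AddSubgroup.closure G, g * d ∈ N := by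
      intro g hg
      induction hg using AddSubgroup.closure_induction with
      | mem g hg => exact h g hg
      | zero => rw [zero_mul]; exact zero_mem _
      | add x y _ _ hx hy => rw [add_mul]; exact add_mem hx hy
      | neg x _ hx => rw [neg_mul]; exact neg_mem hx
    simpa using this 1 h1
  let colon : Submodule O D → Submodule O D := fun N ↦
    { carrier := {d | ∀ q ∈ P, (q : D) * d ∈ N}
      add_mem' := fun ha hb q hq ↦ by rw [mul_add]; exact N.add_mem (ha q hq) (hb q hq)
      zero_mem' := fun q _ ↦ by rw [mul_zero]; exact N.zero_mem
      smul_mem' := fun a d hd q hq ↦ by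
        have := hd (q * a) (P.mul_mem_right a hq)
        rwa [Subring.coe_mul, mul_assoc] at this }
  have hleft : ∀ M, colon (P • M) = M := by
    intro M
    refine le_antisymm (fun d hd ↦ hmem _ M d hWP ?_) fun d hd q hq ↦
      Submodule.smul_mem_smul hq hd
    rintro _ ⟨w, hw, q, hq, rfl⟩
    rw [mul_assoc]
    refine Submodule.smul_induction_on (p := fun y ↦ w * y ∈ M) (hd q hq) ?_ ?_
    · intro r hr m hm
      have : w * (r • m) = (⟨w * r, hw r hr⟩ : O) • m := (mul_assoc w r m).symm
      rw [this]
      exact M.smul_mem _ hm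
    · intro x y hx hy
      rw [mul_add]
      exact M.add_mem hx hy
  have hright : ∀ N, P • colon N = N := by
    intro N
    refine le_antisymm (Submodule.smul_le.mpr fun q hq d hd ↦ hd q hq) fun d hd ↦
      hmem _ _ d hPW' ?_
    rintro _ ⟨q, hq, w, hw, rfl⟩
    rw [mul_assoc]
    refine Submodule.smul_mem_smul hq fun q' hq' ↦ ?_
    rw [← mul_assoc]
    exact N.smul_mem ⟨q' * w, hPW w hw q' hq'⟩ hd
  refine ⟨{ toFun := fun M ↦ P • M, invFun := colon, left_inv := hleft, right_inv := hright,
            map_rel_iff' := ?_ }, fun M ↦ rfl⟩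
  intro M N
  refine ⟨fun h ↦ ?_, Submodule.smul_mono le_rfl⟩
  rw [← hleft M, ← hleft N]
  exact fun d hd q hq ↦ h (hd q hq)

end Orders

section Determinants

theorem LinearMap.det_mulLeft_eq_det_mulRight (K : Type*) {D : Type*} [Field K] [CharZero K]
    [Ring D] [Algebra K D] [FiniteDimensional K D] [IsSimpleRing D] (x : D) :
    LinearMap.det (LinearMap.mulLeft K x) = LinearMap.det (LinearMap.mulRight K x) := by
  let τ : D →ₗ[K] K := LinearMap.trace K D ∘ₗ (Algebra.lmul K D).toLinearMap
  have hτ : ∀ a b, τ (a * b) = τ (b * a) := by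
    intro a b
    change LinearMap.trace K D (Algebra.lmul K D (a * b)) =
      LinearMap.trace K D (Algebra.lmul K D (b * a))
    rw [map_mul (Algebra.lmul K D), map_mul (Algebra.lmul K D), LinearMap.trace_mul_comm]
  have hτ1 : τ 1 ≠ 0 := by
    change LinearMap.trace K D (Algebra.lmul K D 1) ≠ 0
    rw [map_one, LinearMap.trace_one]
    exact_mod_cast Module.finrank_pos.ne'
  let T : D →ₗ[K] Module.Dual K D := (LinearMap.mul K D).compr₂ τ
  have hT : ∀ a b, T a b = τ (a * b) := fun _ _ ↦ rfl
  let I : TwoSidedIdeal D := TwoSidedIdeal.mk' {a | ∀ b, τ (a * b) = 0}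
    (fun b ↦ by rw [zero_mul, map_zero])
    (fun ha hb c ↦ by rw [add_mul, map_add, ha, hb, add_zero])
    (fun ha c ↦ by rw [neg_mul, map_neg, ha, neg_zero])
    (fun {x y} hy c ↦ by rw [hτ, ← mul_assoc, hτ, hy])
    (fun {x y} hx c ↦ by rw [mul_assoc, hx])
  have hI : ∀ a, a ∈ I ↔ ∀ b, τ (a * b) = 0 := fun a ↦ by
    simp [I, TwoSidedIdeal.mem_mk']
  have hbot : I = ⊥ := by
    refine (eq_bot_or_eq_top I).resolve_right fun h ↦ hτ1 ?_
    have h1 : (1 : D) ∈ I := h ▸ TwoSidedIdeal.mem_top _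
    simpa using (hI 1).mp h1 1
  have hinj : Function.Injective T := by
    rw [← LinearMap.ker_eq_bot, LinearMap.ker_eq_bot']
    intro a ha
    have : a ∈ I := (hI a).mpr fun b ↦ by rw [← hT, ha]; rfl
    rw [hbot] at this
    exact (TwoSidedIdeal.mem_bot _).mp this
  let e : D ≃ₗ[K] Module.Dual K D := LinearEquiv.ofInjectiveOfFinrankEq T hinj
    Subspace.dual_finrank_eq.symm
  have he : ∀ a, e a = T a := fun _ ↦ rfl
  rw [← LinearMap.det_dualMap, ← LinearMap.det_conj (LinearMap.mulRight K x) e]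
  congr 1
  refine LinearMap.ext fun f ↦ ?_
  obtain ⟨a, rfl⟩ := e.surjective f
  refine LinearMap.ext fun b ↦ ?_
  have h : e.symm (T a) = a := e.symm_apply_apply a
  simp [he, hT, mul_assoc, h]

theorem AddSubgroup.relIndex_map_eq_abs_det {E ι : Type*} [AddCommGroup E] [Module ℚ E]
    [Finite ι] {H : AddSubgroup E} (b : Module.Basis ι ℚ E)
    (hb : H = AddSubgroup.closure (Set.range b)) {f : E →ₗ[ℚ] E}
    (hf : H.map f.toAddMonoidHom ≤ H) (hdet : LinearMap.det f ≠ 0) :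
    ((H.map f.toAddMonoidHom).relIndex H : ℚ) = |LinearMap.det f| := by
  classical
  have := Fintype.ofFinite ι
  let e := LinearEquiv.ofIsUnitDet (v := b) (v' := b) (f := f)
    (by rw [LinearMap.det_toMatrix]; exact hdet.isUnit)
  have h1 : H.map f.toAddMonoidHom = AddSubgroup.closure (Set.range (b.map e)) := by
    rw [hb, AddMonoidHom.map_closure, ← Set.range_comp]
    rfl
  rw [AddSubgroup.relIndex_eq_abs_det _ _ hf (b.map e) b h1 hb]
  have h2 : ⇑(b.map e) = f ∘ b := rfl
  rw [h2, Module.Basis.det_comp, Module.Basis.det_self, mul_one]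

variable {D : Type*} [Ring D] [Algebra ℚ D]

theorem Subring.IsOrder.exists_basis {O : Subring D} (hO : O.IsOrder D) :
    ∃ (n : ℕ) (b : Module.Basis (Fin n) ℚ D),
      O.toAddSubgroup = AddSubgroup.closure (Set.range b) := by
  let M := AddSubgroup.toIntSubmodule O.toAddSubgroup
  have : Module.Finite ℤ M := Module.Finite.iff_fg.mpr hO.1
  have : IsAddTorsionFree D := .of_module_rat D
  let c := Module.finBasis ℤ M
  have hspan : Submodule.span ℤ (Set.range fun i ↦ (c i : D)) = M := by
    have h := congrArg (Submodule.map M.subtype) c.span_eq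
    rw [Submodule.map_span, ← Set.range_comp, Submodule.map_top, Submodule.range_subtype] at h
    exact h
  have hli : LinearIndependent ℚ fun i ↦ (c i : D) :=
    (LinearIndependent.iff_fractionRing ℤ ℚ).mp
      (c.linearIndependent.map' M.subtype (Submodule.ker_subtype M))
  refine ⟨_, Module.Basis.mk hli ?_, ?_⟩
  · rw [← hO.2]
    refine Submodule.span_le.mpr fun x hx ↦ ?_
    have hx : x ∈ Submodule.span ℤ (Set.range fun i ↦ (c i : D)) := hspan.symm ▸ hx
    exact Submodule.span_subset_span ℤ ℚ _ hx
  · rw [Module.Basis.coe_mk, ← Submodule.span_int_eq_addSubgroupClosure, hspan]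
    rfl

end Determinants

section Generators

theorem AddCommGroup.not_dvd_card_of_nsmul_surjective {G : Type*} [AddCommGroup G]
    [AddGroup.FG G] {p : ℕ} (hp : p.Prime) (h : ∀ y : G, ∃ z : G, p • z = y) :
    Nat.card G ≠ 0 ∧ ¬ p ∣ Nat.card G := by
  have hfin : Module.Finite ℤ G := Module.Finite.iff_addGroup_fg.mpr inferInstance
  obtain ⟨r, hr, hr0⟩ := Submodule.exists_sub_one_mem_and_smul_eq_zero_of_fg_of_le_smul
    (Ideal.span {(p : ℤ)}) (⊤ : Submodule ℤ G) hfin.fg_top fun y _ ↦ by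
      obtain ⟨z, rfl⟩ := h y
      rw [← natCast_zsmul]
      exact Submodule.smul_mem_smul (Ideal.mem_span_singleton_self _) Submodule.mem_top
  rw [Ideal.mem_span_singleton] at hr
  have hpr : ¬ (p : ℤ) ∣ r := fun h' ↦ by
    have := (dvd_sub_right h').mp hr
    exact (Nat.prime_iff_prime_int.mp hp).not_dvd_one this
  have hr' : r ≠ 0 := fun h' ↦ hpr (h' ▸ dvd_zero _)
  have htors : IsAddTorsion G := fun y ↦
    isOfFinAddOrder_iff_zsmul_eq_zero.mpr ⟨r, hr', hr0 y Submodule.mem_top⟩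
  have := AddCommGroup.finite_of_fg_isAddTorsion G htors
  refine ⟨Nat.card_pos.ne', fun hdvd ↦ hpr ?_⟩
  have := Fact.mk hp
  obtain ⟨y, hy⟩ := exists_prime_addOrderOf_dvd_card' p hdvd
  rw [← hy]
  exact addOrderOf_dvd_iff_zsmul_eq_zero.mpr (hr0 y Submodule.mem_top)

variable {D : Type*} [Ring D] [Algebra ℚ D]

theorem Subring.IsMaximalOrder.exists_le_span_singleton_sup_smul {O : Subring D}
    (hO : O.IsMaximalOrder D) {n : ℕ} (hn : n ≠ 0) {P : Ideal O} (hP : P.IsMaximalTwoSided)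
    (hnP : (n : O) ∈ P) {I : Submodule O D} (hI : I.toAddSubgroup ≤ O.toAddSubgroup)
    (hfin : I.toAddSubgroup.relIndex O.toAddSubgroup ≠ 0) :
    ∃ x ∈ I, I ≤ Submodule.span O {x} ⊔ P • I := by
  have hPfin : Finite (O ⧸ P) := hO.1.finite_quotient hn P hnP
  obtain ⟨e, he⟩ := hO.exists_orderIso hn hP hnP
  let f : O →ₗ[O] D := LinearMap.toSpanSingleton O D 1
  have hf : ∀ a : O, f a = a := fun a ↦ mul_one (a : D)
  have hfinj : Function.Injective f := fun a b hab ↦ Subtype.ext (by rw [← hf, ← hf, hab])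
  let Λ : Submodule O D := Submodule.map f ⊤
  have hΛ : Λ.toAddSubgroup = O.toAddSubgroup := by
    ext d
    refine ⟨?_, fun hd ↦ ⟨⟨d, hd⟩, trivial, hf _⟩⟩
    rintro ⟨a, -, rfl⟩
    rw [hf]
    exact a.2
  have hIΛ : I ≤ Λ := fun x hx ↦ by
    have : x ∈ Λ.toAddSubgroup := hΛ ▸ hI hx
    exact this
  have hPΛ : P • Λ = Submodule.map f P := by
    rw [← Submodule.map_smul'']
    congr 1
    have := hP.isTwoSided
    exact Ideal.mul_top P
  have hcardΛ : (P • Λ).toAddSubgroup.relIndex Λ.toAddSubgroup = Nat.card (O ⧸ P) := by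
    rw [hPΛ]
    refine (AddSubgroup.relIndex_map_map_of_injective (f := f.toAddMonoidHom) P.toAddSubgroup
      (⊤ : Ideal O).toAddSubgroup hfinj).trans ?_
    exact AddSubgroup.relIndex_top_right _
  rw [← hΛ] at hfin
  have h1 := AddSubgroup.relIndex_mul_relIndex (P • I).toAddSubgroup I.toAddSubgroup
    Λ.toAddSubgroup Submodule.smul_le_right hIΛ
  have h2 := AddSubgroup.relIndex_mul_relIndex (P • I).toAddSubgroup (P • Λ).toAddSubgroup
    Λ.toAddSubgroup (Submodule.smul_mono le_rfl hIΛ) Submodule.smul_le_right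
  rw [hP.relIndex_smul e he hIΛ hfin, hcardΛ, mul_comm] at h2
  have hcard : (P • I).toAddSubgroup.relIndex I.toAddSubgroup = Nat.card (O ⧸ P) :=
    Nat.eq_of_mul_eq_mul_right (Nat.pos_of_ne_zero hfin) (h1.trans h2.symm)
  rw [Submodule.relIndex_eq_card_quotient] at hcard
  have htors : Module.IsTorsionBySet O (I ⧸ (P • I).comap I.subtype) P := by
    intro y b
    obtain ⟨y, rfl⟩ := Submodule.Quotient.mk_surjective _ y
    rw [← Submodule.Quotient.mk_smul, Submodule.Quotient.mk_eq_zero]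
    exact Submodule.smul_mem_smul b.2 y.2
  obtain ⟨x, hx⟩ := hP.exists_span_singleton_eq_top htors hcard
  obtain ⟨x, rfl⟩ := Submodule.Quotient.mk_surjective _ x
  refine ⟨x, x.2, fun y hy ↦ ?_⟩
  obtain ⟨a, ha⟩ := hx (Submodule.Quotient.mk ⟨y, hy⟩)
  rw [← Submodule.Quotient.mk_smul, eq_comm, Submodule.Quotient.eq] at ha
  have ha : y - a • (x : D) ∈ P • I := ha
  rw [← add_sub_cancel (a • (x : D)) y]
  exact Submodule.add_mem_sup (Submodule.smul_mem _ a (Submodule.mem_span_singleton_self _)) ha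

theorem Subring.IsMaximalOrder.exists_forall_exists_eq_smul_add {O : Subring D}
    (hO : O.IsMaximalOrder D) {n : ℕ} (hn : n ≠ 0) {I : Submodule O D}
    (hI : I.toAddSubgroup ≤ O.toAddSubgroup)
    (hfin : I.toAddSubgroup.relIndex O.toAddSubgroup ≠ 0) :
    ∃ x ∈ I, ∀ y ∈ I, ∃ a : O, ∃ z ∈ I, y = a • x + n • z := by
  obtain ⟨l, hl, hle⟩ := hO.1.exists_listProd_le hn
  obtain ⟨x, hxI, hx⟩ := Submodule.exists_forall_le_span_singleton_sup_smul (M := I)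
    (fun P hP ↦ (hl P hP).1)
    fun P hP ↦ hO.exists_le_span_singleton_sup_smul hn (hl P hP).1 (hl P hP).2 hI hfin
  refine ⟨x, hxI, fun y hy ↦ ?_⟩
  obtain ⟨u, hu, v, hv, rfl⟩ := Submodule.mem_sup.mp (Submodule.le_sup_listProd_smul hx hy)
  obtain ⟨a, rfl⟩ := Submodule.mem_span_singleton.mp hu
  suffices ∃ z ∈ I, v = n • z by
    obtain ⟨z, hz, rfl⟩ := this
    exact ⟨a, z, hz, rfl⟩
  refine Submodule.smul_induction_on hv ?_ ?_
  · intro b hb m hm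
    obtain ⟨c, rfl⟩ := Ideal.mem_span_singleton'.mp (hle hb)
    refine ⟨c • m, I.smul_mem c hm, ?_⟩
    rw [← Nat.cast_comm, mul_smul, Nat.cast_smul_eq_nsmul]
  · rintro _ _ ⟨z, hz, rfl⟩ ⟨w, hw, rfl⟩
    exact ⟨z + w, I.add_mem hz hw, (smul_add _ _ _).symm⟩

/-- A left ideal of a maximal order is generated by a single element, up to an index prime to a
given prime number. -/
theorem Subring.IsMaximalOrder.exists_not_dvd_relIndex_span_singleton {O : Subring D}
    (hO : O.IsMaximalOrder D) {p : ℕ} (hp : p.Prime) {I : Submodule O D}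
    (hI : I.toAddSubgroup ≤ O.toAddSubgroup)
    (hfin : I.toAddSubgroup.relIndex O.toAddSubgroup ≠ 0) :
    ∃ x ∈ I, (Submodule.span O {x}).toAddSubgroup.relIndex I.toAddSubgroup ≠ 0 ∧
      ¬ p ∣ (Submodule.span O {x}).toAddSubgroup.relIndex I.toAddSubgroup := by
  obtain ⟨x, hxI, hx⟩ := hO.exists_forall_exists_eq_smul_add hp.ne_zero hI hfin
  refine ⟨x, hxI, ?_⟩
  have hfg : (AddSubgroup.toIntSubmodule I.toAddSubgroup).FG :=
    Subring.fg_of_nsmul_mem hO.1 one_ne_zero fun y hy ↦ by rw [one_smul]; exact hI hy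
  have : Module.Finite ℤ I := Module.Finite.iff_fg.mpr hfg
  have : AddGroup.FG I := Module.Finite.iff_addGroup_fg.mp this
  rw [Submodule.relIndex_eq_card_quotient]
  have : AddGroup.FG (I ⧸ (Submodule.span O {x}).comap I.subtype) :=
    inferInstanceAs (AddGroup.FG (I ⧸ ((Submodule.span O {x}).comap I.subtype).toAddSubgroup))
  refine AddCommGroup.not_dvd_card_of_nsmul_surjective hp fun y ↦ ?_
  obtain ⟨y, rfl⟩ := Submodule.Quotient.mk_surjective _ y
  obtain ⟨a, z, hz, hy⟩ := hx y y.2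
  refine ⟨Submodule.Quotient.mk ⟨z, hz⟩, ?_⟩
  rw [← Submodule.Quotient.mk_smul, eq_comm, Submodule.Quotient.eq]
  have : (y : D) - p • z = a • x := by rw [hy, add_sub_cancel_right]
  change (y : D) - p • z ∈ Submodule.span O {x}
  rw [this]
  exact Submodule.smul_mem _ a (Submodule.mem_span_singleton_self _)

end Generators

section IndexComparison

variable {D : Type*} [Ring D] [Algebra ℚ D] [IsSimpleRing D]

theorem Subring.IsMaximalOrder.exists_relIndex_dvd_mul {R O₁ O₂ : Subring D} (hR : R.IsOrder D)
    (hO₁ : O₁.IsMaximalOrder D) (hO₂ : O₂.IsOrder D) (hRO₁ : R ≤ O₁) (hRO₂ : R ≤ O₂)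
    {p : ℕ} (hp : p.Prime) : ∃ c : ℕ, ¬ p ∣ c ∧
      R.toAddSubgroup.relIndex O₂.toAddSubgroup ∣
        R.toAddSubgroup.relIndex O₁.toAddSubgroup * c := by
  let M₁ := AddSubgroup.toIntSubmodule O₁.toAddSubgroup
  let M₂ := AddSubgroup.toIntSubmodule O₂.toAddSubgroup
  obtain ⟨n, hn, hnR⟩ := hR.exists_forall_nsmul_mem (hO₁.1.1.mul hO₂.1 : (M₁ * M₂).FG)
  have hleft : ∀ a ∈ O₁, ∀ j ∈ M₁ * M₂, a * j ∈ M₁ * M₂ := by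
    intro a ha j hj
    have h : M₁ * M₁ ≤ M₁ := Submodule.mul_le.mpr fun x hx y hy ↦ O₁.mul_mem hx hy
    have h' : a * j ∈ M₁ * (M₁ * M₂) := Submodule.mul_mem_mul ha hj
    rw [← mul_assoc] at h'
    exact mul_le_mul' h le_rfl h'
  have hright : ∀ a ∈ O₂, ∀ j ∈ M₁ * M₂, j * a ∈ M₁ * M₂ := by
    intro a ha j hj
    have h : M₂ * M₂ ≤ M₂ := Submodule.mul_le.mpr fun x hx y hy ↦ O₂.mul_mem hx hy
    have h' : j * a ∈ M₁ * M₂ * M₂ := Submodule.mul_mem_mul hj ha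
    rw [mul_assoc] at h'
    exact mul_le_mul' le_rfl h h'
  let I : Submodule O₁ D :=
    { carrier := {d | ∃ j ∈ M₁ * M₂, n • j = d}
      add_mem' := by
        rintro _ _ ⟨j, hj, rfl⟩ ⟨k, hk, rfl⟩
        exact ⟨j + k, add_mem hj hk, smul_add _ _ _⟩
      zero_mem' := ⟨0, zero_mem _, smul_zero _⟩
      smul_mem' := by
        rintro a _ ⟨j, hj, rfl⟩
        exact ⟨a * j, hleft a a.2 j hj, (mul_smul_comm n (a : D) j).symm⟩ }
  have hIR : I.toAddSubgroup ≤ R.toAddSubgroup := by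
    rintro _ ⟨j, hj, rfl⟩
    exact hnR j hj
  have h₁ : I.toAddSubgroup.relIndex O₁.toAddSubgroup ≠ 0 :=
    AddSubgroup.relIndex_ne_zero_of_nsmul_mem hO₁.1.1 hn fun a ha ↦
      ⟨a, mul_one a ▸ Submodule.mul_mem_mul (M := M₁) (N := M₂) ha O₂.one_mem, rfl⟩
  have h₂ : I.toAddSubgroup.relIndex O₂.toAddSubgroup ≠ 0 :=
    AddSubgroup.relIndex_ne_zero_of_nsmul_mem hO₂.1 hn fun a ha ↦
      ⟨a, one_mul a ▸ Submodule.mul_mem_mul (M := M₁) (N := M₂) O₁.one_mem ha, rfl⟩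
  have hI₁ : I.toAddSubgroup ≤ O₁.toAddSubgroup := hIR.trans hRO₁
  have hI₂ : I.toAddSubgroup ≤ O₂.toAddSubgroup := hIR.trans hRO₂
  obtain ⟨x, hxI, hx0, hxp⟩ := hO₁.exists_not_dvd_relIndex_span_singleton hp hI₁ h₁
  refine ⟨_, hxp, ?_⟩
  obtain ⟨m₁, b₁, hb₁⟩ := hO₁.1.exists_basis
  obtain ⟨m₂, b₂, hb₂⟩ := hO₂.exists_basis
  have : FiniteDimensional ℚ D := Module.Finite.of_basis b₁
  have hspan : (Submodule.span O₁ {x}).toAddSubgroup =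
      O₁.toAddSubgroup.map (LinearMap.mulRight ℚ x).toAddMonoidHom := by
    ext d
    rw [Submodule.mem_toAddSubgroup, Submodule.mem_span_singleton]
    refine ⟨?_, ?_⟩
    · rintro ⟨a, rfl⟩
      exact ⟨a, a.2, rfl⟩
    · rintro ⟨a, ha, rfl⟩
      exact ⟨⟨a, ha⟩, rfl⟩
  have hspanI : O₁.toAddSubgroup.map (LinearMap.mulRight ℚ x).toAddMonoidHom ≤
      I.toAddSubgroup := by
    rw [← hspan]
    exact (Submodule.span_singleton_le_iff_mem x I).mpr hxI
  have hspanI' : O₂.toAddSubgroup.map (LinearMap.mulLeft ℚ x).toAddMonoidHom ≤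
      I.toAddSubgroup := by
    obtain ⟨j, hj, rfl⟩ := hxI
    rintro _ ⟨a, ha, rfl⟩
    exact ⟨j * a, hright a ha j hj, (smul_mul_assoc n j a).symm⟩
  rw [hspan] at hx0 ⊢
  have hmul₁ := AddSubgroup.relIndex_mul_relIndex _ _ _ hspanI hI₁
  have hmul₂ := AddSubgroup.relIndex_mul_relIndex _ _ _ hspanI' hI₂
  have hdet : LinearMap.det (LinearMap.mulRight ℚ x) ≠ 0 := by
    have hk := mul_ne_zero hx0 h₁
    rw [hmul₁] at hk
    obtain ⟨a, -, hax⟩ := AddSubgroup.nsmul_index_mem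
      ((O₁.toAddSubgroup.map (LinearMap.mulRight ℚ x).toAddMonoidHom).addSubgroupOf
        O₁.toAddSubgroup) (⟨1, O₁.one_mem⟩ : O₁.toAddSubgroup)
    change ((O₁.toAddSubgroup.map (LinearMap.mulRight ℚ x).toAddMonoidHom).addSubgroupOf
      O₁.toAddSubgroup).index ≠ 0 at hk
    set k := ((O₁.toAddSubgroup.map (LinearMap.mulRight ℚ x).toAddMonoidHom).addSubgroupOf
      O₁.toAddSubgroup).index
    have hax : a * x = k • (1 : D) := hax
    have hk : (k : ℚ) ≠ 0 := Nat.cast_ne_zero.mpr hk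
    have hsurj : Function.Surjective (LinearMap.mulRight ℚ x) := fun d ↦ by
      refine ⟨(k : ℚ)⁻¹ • (d * a), ?_⟩
      rw [LinearMap.mulRight_apply, smul_mul_assoc, mul_assoc, hax, mul_smul_comm, mul_one,
        ← Nat.cast_smul_eq_nsmul ℚ, inv_smul_smul₀ hk]
    exact (((LinearMap.isUnit_iff_range_eq_top _).mpr
      (LinearMap.range_eq_top.mpr hsurj)).map LinearMap.det).ne_zero
  have hdet₁ := AddSubgroup.relIndex_map_eq_abs_det b₁ hb₁ (hspanI.trans hI₁) hdet
  have hdet₂ := AddSubgroup.relIndex_map_eq_abs_det b₂ hb₂ (hspanI'.trans hI₂)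
    (by rwa [LinearMap.det_mulLeft_eq_det_mulRight])
  rw [LinearMap.det_mulLeft_eq_det_mulRight, ← hdet₁, Nat.cast_inj] at hdet₂
  rw [← hmul₁, ← hmul₂, ← AddSubgroup.relIndex_mul_relIndex _ _ O₁.toAddSubgroup hIR hRO₁,
    ← AddSubgroup.relIndex_mul_relIndex _ _ O₂.toAddSubgroup hIR hRO₂] at hdet₂
  have hIR0 : I.toAddSubgroup.relIndex R.toAddSubgroup ≠ 0 := fun h ↦ h₁ (by
    rw [← AddSubgroup.relIndex_mul_relIndex _ _ O₁.toAddSubgroup hIR hRO₁, h, zero_mul])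
  refine ⟨(O₂.toAddSubgroup.map (LinearMap.mulLeft ℚ x).toAddMonoidHom).relIndex
    I.toAddSubgroup, Nat.eq_of_mul_eq_mul_left (Nat.pos_of_ne_zero hIR0) ?_⟩
  linarith

theorem Subring.IsMaximalOrder.relIndex_dvd_relIndex {R O₁ O₂ : Subring D} (hR : R.IsOrder D)
    (hO₁ : O₁.IsMaximalOrder D) (hO₂ : O₂.IsOrder D) (hRO₁ : R ≤ O₁) (hRO₂ : R ≤ O₂) :
    R.toAddSubgroup.relIndex O₂.toAddSubgroup ∣ R.toAddSubgroup.relIndex O₁.toAddSubgroup := by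
  rw [Nat.dvd_iff_prime_pow_dvd_dvd]
  intro p k hp hk
  obtain ⟨c, hpc, hc⟩ := hO₁.exists_relIndex_dvd_mul hR hO₂ hRO₁ hRO₂ hp
  exact (((Nat.Prime.coprime_iff_not_dvd hp).mpr hpc).pow_left k).dvd_of_dvd_mul_right (hk.trans hc)

end IndexComparison

theorem stmt11 (L : Type*) [Field L] [NumberField L]
    (D : Type*) [Ring D] [Algebra L D] [FiniteDimensional L D]
    [Algebra ℚ D] [IsScalarTower ℚ L D]
    [Algebra.IsCentral L D] [IsSimpleRing D]
    (R O₁ O₂ : Subring D) (hR : R.IsOrder D)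
    (hO₁ : O₁.IsMaximalOrder D) (hO₂ : O₂.IsMaximalOrder D)
    (hRO₁ : R ≤ O₁) (hRO₂ : R ≤ O₂) :
    (R.toAddSubgroup.addSubgroupOf O₁.toAddSubgroup).index
      = (R.toAddSubgroup.addSubgroupOf O₂.toAddSubgroup).index := by
  exact Nat.dvd_antisymm (hO₂.relIndex_dvd_relIndex hR hO₁.1 hRO₂ hRO₁)
    (hO₁.relIndex_dvd_relIndex hR hO₂.1 hRO₁ hRO₂)
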